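/- Let {∃,⊓} ⊆ O ⊆ {∀,∃,≥,−,⊓,⊔,⊤,⊥,¬}. (1) If O ⊆ {∃,⊓,⊤,⊥}, then L(O) admits finite characterisations under every DL-Lite ontology. (2) Otherwise, if it is not the case that {∃,⊓,⊔} ⊆ O ⊆ {∃,⊓,⊔,⊤,⊥}, then there exists a DL-Lite ontology O' such that L(O) does not admit finite characterisations under O'. -/

import Mathlib

namespace DL

/-! ### Syntax of ALCQI concepts -/

/-- Roles: role names (indexed by ℕ) and inverse roles. -/
inductive Role where
  | name : ℕ → Role
  | inv  : ℕ → Role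
deriving DecidableEq

/-- ALCQI concept expressions. -/
inductive Concept where
  | atom : ℕ → Concept
  | top  : Concept
  | bot  : Concept
  | and  : Concept → Concept → Concept
  | or   : Concept → Concept → Concept
  | neg  : Concept → Concept
  | ex   : Role → Concept → Concept
  | all  : Role → Concept → Concept
  | atLeast : ℕ → Role → Concept → Concept
deriving DecidableEq

/-- The operators/constructors that a concept language may use. -/
inductive Op where
  | all | ex | ge | inv | and | or | top | bot | neg
deriving DecidableEq

/-! ### Interpretations and semantics -/

/-- An interpretation: a nonempty domain, interpretations of concept names
and of role names. -/
structure Interp where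
  Δ : Type
  dom_nonempty : Nonempty Δ
  atom : ℕ → Set Δ
  rel : ℕ → Δ → Δ → Prop

def Role.sem (I : Interp) : Role → (I.Δ → I.Δ → Prop)
  | .name R => I.rel R
  | .inv R  => fun d e => I.rel R e d

def Concept.sem (I : Interp) : Concept → Set I.Δ
  | .atom A => I.atom A
  | .top => Set.univ
  | .bot => ∅
  | .and C D => C.sem I ∩ D.sem I
  | .or C D => C.sem I ∪ D.sem I
  | .neg C => (C.sem I)ᶜ
  | .ex S C => {d | ∃ e, S.sem I d e ∧ e ∈ C.sem I}
  | .all S C => {d | ∀ e, S.sem I d e → e ∈ C.sem I}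
  | .atLeast k S C => {d | ∃ s : Finset I.Δ, s.card = k ∧ ∀ e ∈ s, S.sem I d e ∧ e ∈ C.sem I}

/-! ### Concept languages L(Os)[SC, SR] -/

def Role.inSig (Os : Finset Op) (SR : Finset ℕ) : Role → Prop
  | .name R => R ∈ SR
  | .inv R  => Op.inv ∈ Os ∧ R ∈ SR

/-- Membership of a concept in the language `L(Os)[SC, SR]`. -/
def Concept.inLang (Os : Finset Op) (SC SR : Finset ℕ) : Concept → Prop
  | .atom A => A ∈ SC
  | .top => Op.top ∈ Os
  | .bot => Op.bot ∈ Os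
  | .and C D => Op.and ∈ Os ∧ C.inLang Os SC SR ∧ D.inLang Os SC SR
  | .or C D => Op.or ∈ Os ∧ C.inLang Os SC SR ∧ D.inLang Os SC SR
  | .neg C => Op.neg ∈ Os ∧ C.inLang Os SC SR
  | .ex S C => Op.ex ∈ Os ∧ S.inSig Os SR ∧ C.inLang Os SC SR
  | .all S C => Op.all ∈ Os ∧ S.inSig Os SR ∧ C.inLang Os SC SR
  | .atLeast k S C => Op.ge ∈ Os ∧ 1 ≤ k ∧ S.inSig Os SR ∧ C.inLang Os SC SR

/-! ### DL-Lite ontologies -/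

/-- Basic concepts: concept names, ∃R and ∃R⁻. -/
inductive Basic where
  | atom : ℕ → Basic
  | ex : Role → Basic
deriving DecidableEq

def Basic.sem (I : Interp) : Basic → Set I.Δ
  | .atom A => I.atom A
  | .ex S => {d | ∃ e, S.sem I d e}

/-- A DL-Lite concept inclusion `B ⊑ C` where `C` is a basic concept
(`negated = false`) or a negated basic concept (`negated = true`). -/
structure CI where
  lhs : Basic
  rhs : Basic
  negated : Bool
deriving DecidableEq

def CI.sat (I : Interp) (ci : CI) : Prop :=
  if ci.negated then ci.lhs.sem I ⊆ (ci.rhs.sem I)ᶜ else ci.lhs.sem I ⊆ ci.rhs.sem I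

/-- A DL-Lite ontology: a finite set (list) of concept inclusions. -/
abbrev Ontology := List CI

def Interp.satO (I : Interp) (Ont : Ontology) : Prop := ∀ ci ∈ Ont, ci.sat I

/-! ### Pointed interpretations, examples, characterisations -/

structure PInterp where
  I : Interp
  pt : I.Δ

/-- A pointed interpretation is finite if its domain is finite. -/
def PInterp.finite (P : PInterp) : Prop := Finite P.I.Δ

/-- `C` fits a collection `(Epos, Eneg)` of labelled examples. -/
def Fits (C : Concept) (Epos Eneg : List PInterp) : Prop :=
  (∀ e ∈ Epos, e.pt ∈ C.sem e.I) ∧ (∀ e ∈ Eneg, e.pt ∉ C.sem e.I)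

/-- Equivalence of concepts. -/
def CEquiv (C D : Concept) : Prop := ∀ I : Interp, C.sem I = D.sem I

/-- Equivalence of concepts relative to an ontology. -/
def CEquivO (Ont : Ontology) (C D : Concept) : Prop :=
  ∀ I : Interp, I.satO Ont → C.sem I = D.sem I

/-- `⊨ C ⊑ D`. -/
def Subsumes (C D : Concept) : Prop := ∀ I : Interp, C.sem I ⊆ D.sem I

/-- `Ont ⊨ C ⊑ D`. -/
def SubsumesO (Ont : Ontology) (C D : Concept) : Prop :=
  ∀ I : Interp, I.satO Ont → C.sem I ⊆ D.sem I

/-- `(Epos, Eneg)` is a finite characterisation of `C` w.r.t. the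
concept language (predicate) `L`: all examples are finite, `C` fits,
and every fitting concept of `L` is equivalent to `C`. -/
def FinChar (L : Concept → Prop) (C : Concept) (Epos Eneg : List PInterp) : Prop :=
  (∀ e ∈ Epos ++ Eneg, e.finite) ∧
  Fits C Epos Eneg ∧
  ∀ D, L D → Fits D Epos Eneg → CEquiv C D

/-- Finite characterisation of `C` w.r.t. `L` under an ontology `Ont`:
all examples are finite and satisfy `Ont`, `C` fits, and every fitting
concept of `L` is equivalent to `C` relative to `Ont`. -/
def FinCharO (Ont : Ontology) (L : Concept → Prop) (C : Concept)
    (Epos Eneg : List PInterp) : Prop :=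
  (∀ e ∈ Epos ++ Eneg, e.finite ∧ e.I.satO Ont) ∧
  Fits C Epos Eneg ∧
  ∀ D, L D → Fits D Epos Eneg → CEquivO Ont C D

/-- `L(Os)` admits finite characterisations. -/
def AdmitsFinChar (Os : Finset Op) : Prop :=
  ∀ SC SR : Finset ℕ, ∀ C : Concept, C.inLang Os SC SR →
    ∃ Epos Eneg : List PInterp, FinChar (Concept.inLang Os SC SR) C Epos Eneg

/-- `L(Os)` admits finite characterisations under the ontology `Ont`. -/
def AdmitsFinCharO (Os : Finset Op) (Ont : Ontology) : Prop :=
  ∀ SC SR : Finset ℕ, ∀ C : Concept, C.inLang Os SC SR →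
    ∃ Epos Eneg : List PInterp, FinCharO Ont (Concept.inLang Os SC SR) C Epos Eneg

/-! ### Size, role depth, number restrictions -/

/-- Number of symbols of a concept expression (numbers in binary). -/
def Concept.size : Concept → ℕ
  | .atom _ => 1
  | .top => 1
  | .bot => 1
  | .and C D => C.size + D.size + 1
  | .or C D => C.size + D.size + 1
  | .neg C => C.size + 1
  | .ex _ C => C.size + 2
  | .all _ C => C.size + 2
  | .atLeast k _ C => C.size + 2 + Nat.size k

/-- Role depth of a concept. -/
def Concept.dp : Concept → ℕ
  | .atom _ => 0
  | .top => 0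
  | .bot => 0
  | .and C D => max C.dp D.dp
  | .or C D => max C.dp D.dp
  | .neg C => C.dp
  | .ex _ C => C.dp + 1
  | .all _ C => C.dp + 1
  | .atLeast _ _ C => C.dp + 1

/-- The largest number occurring in a number restriction of `C` (0 if none). -/
def Concept.nr : Concept → ℕ
  | .atom _ => 0
  | .top => 0
  | .bot => 0
  | .and C D => max C.nr D.nr
  | .or C D => max C.nr D.nr
  | .neg C => C.nr
  | .ex _ C => C.nr
  | .all _ C => C.nr
  | .atLeast k _ C => max k C.nr

/-! ### Satisfiability -/

/-- `C` is satisfiable relative to `Ont`. -/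
def SatO (Ont : Ontology) (C : Concept) : Prop :=
  ∃ I : Interp, I.satO Ont ∧ ∃ d, d ∈ C.sem I

theorem SubsumesO.satO {Ont : Ontology} {C D : Concept} (h : SubsumesO Ont C D)
    (hC : SatO Ont C) : SatO Ont D := by
  obtain ⟨I, hI, d, hd⟩ := hC
  exact ⟨I, hI, d, h I hI hd⟩

/-! ### Finite sets of relevant concepts -/

/-- The subconcepts of a concept. -/
def Concept.subs : Concept → Set Concept
  | .atom A => {.atom A}
  | .top => {.top}
  | .bot => {.bot}
  | .and C D => insert (.and C D) (C.subs ∪ D.subs)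
  | .or C D => insert (.or C D) (C.subs ∪ D.subs)
  | .neg C => insert (.neg C) C.subs
  | .ex S C => insert (.ex S C) C.subs
  | .all S C => insert (.all S C) C.subs
  | .atLeast k S C => insert (.atLeast k S C) C.subs

theorem Concept.finite_subs (C : Concept) : C.subs.Finite := by
  induction C <;> simp_all [Concept.subs]

theorem Concept.self_mem_subs (C : Concept) : C ∈ C.subs := by
  cases C <;> simp [Concept.subs]

/-- The subconcepts of `C` together with all basic concepts over names below `N`. -/
def relevant (N : ℕ) (C : Concept) : Set Concept :=
  C.subs ∪ (Concept.atom '' Set.Iio N ∪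
    ((fun R => Concept.ex (.name R) .top) '' Set.Iio N ∪
      (fun R => Concept.ex (.inv R) .top) '' Set.Iio N))

theorem finite_relevant (N : ℕ) (C : Concept) : (relevant N C).Finite :=
  C.finite_subs.union (((Set.finite_Iio N).image _).union
    (((Set.finite_Iio N).image _).union ((Set.finite_Iio N).image _)))

theorem subs_subset_relevant (N : ℕ) (C : Concept) : C.subs ⊆ relevant N C :=
  Set.subset_union_left

theorem atom_mem_relevant {N A : ℕ} {C : Concept} (h : A < N) : .atom A ∈ relevant N C :=
  Or.inr (Or.inl ⟨A, h, rfl⟩)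

theorem exName_mem_relevant {N R : ℕ} {C : Concept} (h : R < N) :
    .ex (.name R) .top ∈ relevant N C :=
  Or.inr (Or.inr (Or.inl ⟨R, h, rfl⟩))

theorem exInv_mem_relevant {N R : ℕ} {C : Concept} (h : R < N) :
    .ex (.inv R) .top ∈ relevant N C :=
  Or.inr (Or.inr (Or.inr ⟨R, h, rfl⟩))

/-- A basic concept as a concept expression. -/
def Basic.toConcept : Basic → Concept
  | .atom A => .atom A
  | .ex S => .ex S .top

theorem Basic.sem_toConcept (B : Basic) (I : Interp) : B.toConcept.sem I = B.sem I := by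
  cases B <;> simp [Basic.toConcept, Concept.sem, Basic.sem]

/-- The concept or role name occurring in a basic concept. -/
def Basic.idx : Basic → ℕ
  | .atom A => A
  | .ex (.name R) => R
  | .ex (.inv R) => R

theorem exists_bound (Ont : Ontology) (SC SR : Finset ℕ) :
    ∃ N, (∀ ci ∈ Ont, ci.lhs.idx < N ∧ ci.rhs.idx < N) ∧ (∀ A ∈ SC, A < N) ∧ ∀ R ∈ SR, R < N := by
  have h : ∀ᶠ N in Filter.atTop, (∀ ci ∈ Ont.toFinset, ci.lhs.idx < N ∧ ci.rhs.idx < N) ∧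
      (∀ A ∈ SC, A < N) ∧ ∀ R ∈ SR, R < N := by
    simp only [Filter.eventually_and, Filter.eventually_all_finset]
    exact ⟨fun ci _ => ⟨Filter.eventually_gt_atTop _, Filter.eventually_gt_atTop _⟩,
      fun A _ => Filter.eventually_gt_atTop _, fun R _ => Filter.eventually_gt_atTop _⟩
  obtain ⟨N, hN⟩ := h.exists
  exact ⟨N, by simpa using hN⟩

/-- A set of basic concepts respecting all inclusions of an ontology. -/
def RespectsO (Ont : Ontology) (Q : Basic → Prop) : Prop :=
  ∀ ci ∈ Ont, Q ci.lhs → if ci.negated then ¬ Q ci.rhs else Q ci.rhs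

theorem satO_iff {Ont : Ontology} {I : Interp} :
    I.satO Ont ↔ ∀ x, RespectsO Ont (fun B => x ∈ B.sem I) := by
  constructor
  · intro h x ci hci hx
    have h' := h ci hci
    unfold CI.sat at h'
    split_ifs at h' ⊢ <;> exact h' hx
  · intro h ci hci
    unfold CI.sat
    split_ifs with hn
    · intro x hx
      have h' := h x ci hci hx
      rwa [if_pos hn] at h'
    · intro x hx
      have h' := h x ci hci hx
      rwa [if_neg hn] at h'

theorem satO_of_respectsO {Ont : Ontology} {I : Interp} {N : ℕ}
    (hN : ∀ ci ∈ Ont, ci.lhs.idx < N ∧ ci.rhs.idx < N)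
    (h : ∀ x : I.Δ, ∃ Q, RespectsO Ont Q ∧ ∀ B : Basic, B.idx < N → (x ∈ B.sem I ↔ Q B)) :
    I.satO Ont := by
  rw [satO_iff]
  intro x ci hci hx
  obtain ⟨Q, hQ, hB⟩ := h x
  have h' := hQ ci hci ((hB _ (hN ci hci).1).1 hx)
  simpa only [hB _ (hN ci hci).2] using h'

theorem mem_basic_of_subsumesO {Ont : Ontology} {E : Concept} {B : Basic}
    (h : SubsumesO Ont E B.toConcept) (I : Interp) (hI : I.satO Ont) {d : I.Δ}
    (hd : d ∈ E.sem I) : d ∈ B.sem I := by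
  rw [← Basic.sem_toConcept]
  exact h I hI hd

theorem respectsO_subsumesO {Ont : Ontology} {E : Concept} (hE : SatO Ont E) :
    RespectsO Ont (fun B => SubsumesO Ont E B.toConcept) := by
  intro ci hci hl
  split_ifs with hn
  · intro hr
    obtain ⟨I, hI, d, hd⟩ := hE
    have h' := satO_iff.1 hI d ci hci (mem_basic_of_subsumesO hl I hI hd)
    rw [if_pos hn] at h'
    exact h' (mem_basic_of_subsumesO hr I hI hd)
  · intro I hI d hd
    have h' := satO_iff.1 hI d ci hci (mem_basic_of_subsumesO hl I hI hd)
    rw [if_neg hn] at h'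
    rwa [Basic.sem_toConcept]

/-! ### The finite universal model -/

/-- The members of `F` true at an element. -/
def typeAt (F : Set Concept) (I : Interp) (e : I.Δ) : Set Concept :=
  {G | G ∈ F ∧ e ∈ G.sem I}

/-- The types over `F` realised in models of `Ont`. -/
def RealisedType (Ont : Ontology) (F : Set Concept) : Type :=
  {t : Set Concept // ∃ I : Interp, I.satO Ont ∧ ∃ e, t = typeAt F I e}

/-- The type of an element of a model of `Ont`. -/
def realise {Ont : Ontology} (F : Set Concept) {I : Interp} (hI : I.satO Ont) (e : I.Δ) :
    RealisedType Ont F :=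
  ⟨typeAt F I e, I, hI, e, rfl⟩

theorem finite_realisedType (Ont : Ontology) {F : Set Concept} (hF : F.Finite) :
    Finite (RealisedType Ont F) := by
  refine Set.Finite.to_subtype (s := {t | ∃ I : Interp, I.satO Ont ∧ ∃ e, t = typeAt F I e})
    (hF.finite_subsets.subset ?_)
  rintro t ⟨I, -, e, rfl⟩
  exact fun G hG => hG.1

theorem exists_model (Ont : Ontology) : ∃ I : Interp, I.satO Ont :=
  ⟨⟨Unit, ⟨()⟩, fun _ => ∅, fun _ _ _ => False⟩, satO_iff.2 fun _ ci _ h => by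
    exfalso
    cases hB : ci.lhs with
    | atom A => rw [hB] at h; exact h
    | ex S => cases S <;> (rw [hB] at h; obtain ⟨_, h⟩ := h; exact h)⟩

theorem nonempty_realisedType (Ont : Ontology) (F : Set Concept) :
    Nonempty (RealisedType Ont F) := by
  obtain ⟨I, hI⟩ := exists_model Ont
  obtain ⟨e⟩ := I.dom_nonempty
  exact ⟨realise F hI e⟩

/-- `R`-edges between types: the coarsest relation compatible with the members of `F`. -/
def typeRel (F : Set Concept) (R : ℕ) (t t' : Set Concept) : Prop :=
  .ex (.name R) .top ∈ t ∧ .ex (.inv R) .top ∈ t' ∧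
    ∀ G, .ex (.name R) G ∈ F → G ∈ t' → .ex (.name R) G ∈ t

theorem typeRel_typeAt {F : Set Concept} {I : Interp} {R : ℕ} {x y : I.Δ} (h : I.rel R x y)
    (hn : .ex (.name R) .top ∈ F) (hi : .ex (.inv R) .top ∈ F) :
    typeRel F R (typeAt F I x) (typeAt F I y) :=
  ⟨⟨hn, y, h, trivial⟩, ⟨hi, x, h, trivial⟩, fun _ hG hy => ⟨hG, y, h, hy.2⟩⟩

/-- The model of all realised types. -/
def universalModel (Ont : Ontology) (F : Set Concept) : Interp where
  Δ := RealisedType Ont F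
  dom_nonempty := nonempty_realisedType Ont F
  atom A := {t | .atom A ∈ t.1}
  rel R t t' := typeRel F R t.1 t'.1

theorem mem_basic_universalModel {Ont : Ontology} {N : ℕ} {C : Concept} {J : Interp}
    (hJ : J.satO Ont) (e : J.Δ) {B : Basic} (hB : B.idx < N) :
    realise (relevant N C) hJ e ∈ B.sem (universalModel Ont (relevant N C)) ↔ e ∈ B.sem J := by
  match B, hB with
  | .atom A, hB =>
    exact ⟨fun h => h.2, fun h => ⟨atom_mem_relevant hB, h⟩⟩
  | .ex (.name R), hB =>
    constructor
    · rintro ⟨t, ⟨-, y, hy, -⟩, -⟩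
      exact ⟨y, hy⟩
    · rintro ⟨y, hy⟩
      exact ⟨realise _ hJ y, typeRel_typeAt hy (exName_mem_relevant hB) (exInv_mem_relevant hB)⟩
  | .ex (.inv R), hB =>
    constructor
    · rintro ⟨t, -, ⟨-, y, hy, -⟩, -⟩
      exact ⟨y, hy⟩
    · rintro ⟨y, hy⟩
      exact ⟨realise _ hJ y, typeRel_typeAt hy (exName_mem_relevant hB) (exInv_mem_relevant hB)⟩

theorem universalModel_satO {Ont : Ontology} {N : ℕ} (C : Concept)
    (hN : ∀ ci ∈ Ont, ci.lhs.idx < N ∧ ci.rhs.idx < N) :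
    (universalModel Ont (relevant N C)).satO Ont := by
  refine satO_of_respectsO hN ?_
  rintro ⟨_, J, hJ, e, rfl⟩
  exact ⟨_, satO_iff.1 hJ e, fun B hB => mem_basic_universalModel hJ e hB⟩

theorem realise_mem_of_mem {Os : Finset Op}
    (hOs : Os ⊆ ({Op.ex, Op.and, Op.top, Op.bot} : Finset Op))
    {Ont : Ontology} {N : ℕ} {C : Concept} {SC SR : Finset ℕ}
    (hSC : ∀ A ∈ SC, A < N) (hSR : ∀ R ∈ SR, R < N) {J : Interp} (hJ : J.satO Ont)
    {D : Concept} (hD : D.inLang Os SC SR) {e : J.Δ} (he : e ∈ D.sem J) :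
    realise (relevant N C) hJ e ∈ D.sem (universalModel Ont (relevant N C)) := by
  induction D generalizing e with
  | atom A => exact ⟨atom_mem_relevant (hSC A hD), he⟩
  | top => trivial
  | bot => exact he
  | and D E ihD ihE => exact ⟨ihD hD.2.1 he.1, ihE hD.2.2 he.2⟩
  | or => exact absurd (hOs hD.1) (by decide)
  | neg => exact absurd (hOs hD.1) (by decide)
  | ex S D ih =>
    cases S with
    | inv R => exact absurd (hOs hD.2.1.1) (by decide)
    | name R =>
      obtain ⟨y, hy, hyD⟩ := he
      have hR := hSR R hD.2.1
      exact ⟨realise _ hJ y,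
        typeRel_typeAt hy (exName_mem_relevant hR) (exInv_mem_relevant hR), ih hD.2.2 hyD⟩
  | all => exact absurd (hOs hD.1) (by decide)
  | atLeast => exact absurd (hOs hD.1) (by decide)

theorem mem_universalModel_iff {Os : Finset Op}
    (hOs : Os ⊆ ({Op.ex, Op.and, Op.top, Op.bot} : Finset Op))
    {Ont : Ontology} {N : ℕ} {C : Concept} {SC SR : Finset ℕ}
    (hSR : ∀ R ∈ SR, R < N) {G : Concept} (hG : G.inLang Os SC SR)
    (hGF : G.subs ⊆ relevant N C) (t : RealisedType Ont (relevant N C)) :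
    t ∈ G.sem (universalModel Ont (relevant N C)) ↔ G ∈ t.1 := by
  have hmem := hGF G.self_mem_subs
  induction G generalizing t with
  | atom A => exact Iff.rfl
  | top =>
    obtain ⟨_, J, hJ, e, rfl⟩ := t
    exact ⟨fun _ => ⟨hmem, trivial⟩, fun _ => trivial⟩
  | bot =>
    obtain ⟨_, J, hJ, e, rfl⟩ := t
    exact ⟨fun h => h.elim, fun h => h.2.elim⟩
  | and D E ihD ihE =>
    have hDF : D.subs ⊆ relevant N C := fun x hx => hGF (Or.inr (Or.inl hx))
    have hEF : E.subs ⊆ relevant N C := fun x hx => hGF (Or.inr (Or.inr hx))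
    refine (and_congr (ihD hG.2.1 hDF t (hDF D.self_mem_subs))
      (ihE hG.2.2 hEF t (hEF E.self_mem_subs))).trans ?_
    obtain ⟨_, J, hJ, e, rfl⟩ := t
    exact ⟨fun h => ⟨hmem, h.1.2, h.2.2⟩, fun h =>
      ⟨⟨hDF D.self_mem_subs, h.2.1⟩, ⟨hEF E.self_mem_subs, h.2.2⟩⟩⟩
  | or => exact absurd (hOs hG.1) (by decide)
  | neg => exact absurd (hOs hG.1) (by decide)
  | ex S D ih =>
    cases S with
    | inv R => exact absurd (hOs hG.2.1.1) (by decide)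
    | name R =>
      have hR := hSR R hG.2.1
      have hDF : D.subs ⊆ relevant N C := fun x hx => hGF (Or.inr hx)
      have hD := hDF D.self_mem_subs
      constructor
      · rintro ⟨t', hr, ht'⟩
        exact hr.2.2 D hmem ((ih hG.2.2 hDF t' hD).1 ht')
      · intro h
        obtain ⟨_, J, hJ, e, rfl⟩ := t
        obtain ⟨-, y, hy, hyD⟩ := h
        exact ⟨realise _ hJ y,
          typeRel_typeAt hy (exName_mem_relevant hR) (exInv_mem_relevant hR),
          (ih hG.2.2 hDF _ hD).2 ⟨hD, hyD⟩⟩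
  | all => exact absurd (hOs hG.1) (by decide)
  | atLeast => exact absurd (hOs hG.1) (by decide)

/-! ### The finite canonical model -/

/-- The elements of the canonical part: satisfiable concepts that are `C` itself or consist of
the filler of an existential restriction in `F` and the existence of a predecessor. -/
def CanonicalConcept (Ont : Ontology) (F : Set Concept) (C : Concept) : Type :=
  {E : Concept // (E = C ∨ ∃ R G, .ex (.name R) G ∈ F ∧ E = .and G (.ex (.inv R) .top)) ∧
    SatO Ont E}

theorem finite_canonicalConcept (Ont : Ontology) {F : Set Concept} (hF : F.Finite)
    (C : Concept) : Finite (CanonicalConcept Ont F C) := by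
  let f : Concept → Concept := fun
    | .ex (.name R) G => .and G (.ex (.inv R) .top)
    | E => E
  refine (((hF.image f).insert C).subset ?_).to_subtype
  rintro E ⟨rfl | ⟨R, G, hG, rfl⟩, -⟩
  · exact Set.mem_insert _ _
  · exact Or.inr ⟨_, hG, rfl⟩

/-- The canonical model of `C`, with the universal model attached to supply predecessors. -/
def canonicalModel (Ont : Ontology) (F : Set Concept) (C : Concept) : Interp where
  Δ := CanonicalConcept Ont F C ⊕ RealisedType Ont F
  dom_nonempty := (nonempty_realisedType Ont F).map Sum.inr
  atom A := {x | Sum.elim (fun E => SubsumesO Ont E.1 (.atom A)) (fun t => .atom A ∈ t.1) x}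
  rel R x y := match x, y with
    | .inl E, .inl E' =>
      SubsumesO Ont E.1 (.ex (.name R) E'.1) ∧ SubsumesO Ont E'.1 (.ex (.inv R) .top)
    | .inl _, .inr _ => False
    | .inr t, .inl E => .ex (.name R) .top ∈ t.1 ∧ SubsumesO Ont E.1 (.ex (.inv R) .top)
    | .inr t, .inr t' => typeRel F R t.1 t'.1

theorem exists_canonical_successor {Ont : Ontology} {F : Set Concept} {C : Concept}
    (E : CanonicalConcept Ont F C) {R : ℕ} {G : Concept} (hG : .ex (.name R) G ∈ F)
    (h : SubsumesO Ont E.1 (.ex (.name R) G)) :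
    ∃ E' : CanonicalConcept Ont F C, SubsumesO Ont E'.1 G ∧
      (canonicalModel Ont F C).rel R (.inl E) (.inl E') := by
  have h' : SubsumesO Ont E.1 (.ex (.name R) (.and G (.ex (.inv R) .top))) := by
    intro J hJ d hd
    obtain ⟨y, hy, hyG⟩ := h J hJ hd
    exact ⟨y, hy, hyG, d, hy, trivial⟩
  obtain ⟨J, hJ, d, y, -, hy⟩ := h'.satO E.2.2
  exact ⟨⟨.and G (.ex (.inv R) .top), Or.inr ⟨R, G, hG, rfl⟩, J, hJ, y, hy⟩,
    fun _ _ _ hd => hd.1, h', fun _ _ _ hd => hd.2⟩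

theorem mem_basic_canonicalModel_inl {Ont : Ontology} {N : ℕ} {C : Concept}
    (E : CanonicalConcept Ont (relevant N C) C) {B : Basic} (hB : B.idx < N) :
    .inl E ∈ B.sem (canonicalModel Ont (relevant N C) C) ↔ SubsumesO Ont E.1 B.toConcept := by
  match B, hB with
  | .atom A, hB => exact Iff.rfl
  | .ex (.name R), hB =>
    constructor
    · rintro ⟨E' | t, h⟩
      · intro J hJ d hd
        obtain ⟨y, hy, -⟩ := h.1 J hJ hd
        exact ⟨y, hy, trivial⟩
      · exact h.elim
    · intro h
      obtain ⟨E', -, hE'⟩ := exists_canonical_successor E (exName_mem_relevant hB) h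
      exact ⟨_, hE'⟩
  | .ex (.inv R), hB =>
    constructor
    · rintro ⟨E' | t, h⟩
      · exact h.2
      · exact h.2
    · intro h
      obtain ⟨J, hJ, d, hd⟩ := E.2.2
      obtain ⟨y, hy, -⟩ := h J hJ hd
      exact ⟨.inr (realise _ hJ y), ⟨exName_mem_relevant hB, d, hy, trivial⟩, h⟩

theorem mem_basic_canonicalModel_inr {Ont : Ontology} {N : ℕ} {C : Concept} {J : Interp}
    (hJ : J.satO Ont) (e : J.Δ) {B : Basic} (hB : B.idx < N) :
    .inr (realise (relevant N C) hJ e) ∈ B.sem (canonicalModel Ont (relevant N C) C) ↔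
      e ∈ B.sem J := by
  match B, hB with
  | .atom A, hB => exact ⟨fun h => h.2, fun h => ⟨atom_mem_relevant hB, h⟩⟩
  | .ex (.name R), hB =>
    constructor
    · rintro ⟨E' | t, h⟩ <;>
      · obtain ⟨-, y, hy, -⟩ := h.1
        exact ⟨y, hy⟩
    · rintro ⟨y, hy⟩
      exact ⟨.inr (realise _ hJ y),
        typeRel_typeAt hy (exName_mem_relevant hB) (exInv_mem_relevant hB)⟩
  | .ex (.inv R), hB =>
    constructor
    · rintro ⟨E' | t, h⟩
      · exact h.elim
      · obtain ⟨-, y, hy, -⟩ := h.2.1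
        exact ⟨y, hy⟩
    · rintro ⟨y, hy⟩
      exact ⟨.inr (realise _ hJ y),
        typeRel_typeAt hy (exName_mem_relevant hB) (exInv_mem_relevant hB)⟩

theorem canonicalModel_satO {Ont : Ontology} {N : ℕ} (C : Concept)
    (hN : ∀ ci ∈ Ont, ci.lhs.idx < N ∧ ci.rhs.idx < N) :
    (canonicalModel Ont (relevant N C) C).satO Ont := by
  refine satO_of_respectsO hN ?_
  rintro (E | ⟨_, J, hJ, e, rfl⟩)
  · exact ⟨_, respectsO_subsumesO E.2.2, fun B hB => mem_basic_canonicalModel_inl E hB⟩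
  · exact ⟨_, satO_iff.1 hJ e, fun B hB => mem_basic_canonicalModel_inr hJ e hB⟩

theorem subsumesO_of_mem_canonicalModel {Os : Finset Op}
    (hOs : Os ⊆ ({Op.ex, Op.and, Op.top, Op.bot} : Finset Op))
    {Ont : Ontology} {F : Set Concept} {C : Concept}
    {SC SR : Finset ℕ} {D : Concept} (hD : D.inLang Os SC SR) {E : CanonicalConcept Ont F C}
    (h : .inl E ∈ D.sem (canonicalModel Ont F C)) : SubsumesO Ont E.1 D := by
  induction D generalizing E with
  | atom A => exact h
  | top => exact fun _ _ _ _ => trivial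
  | bot => exact h.elim
  | and D D' ih ih' =>
    exact fun J hJ d hd => ⟨ih hD.2.1 h.1 J hJ hd, ih' hD.2.2 h.2 J hJ hd⟩
  | or => exact absurd (hOs hD.1) (by decide)
  | neg => exact absurd (hOs hD.1) (by decide)
  | ex S D ih =>
    cases S with
    | inv R => exact absurd (hOs hD.2.1.1) (by decide)
    | name R =>
      obtain ⟨E' | t, hr, hE'⟩ := h
      · intro J hJ d hd
        obtain ⟨y, hy, hyE⟩ := hr.1 J hJ hd
        exact ⟨y, hy, ih hD.2.2 hE' J hJ hyE⟩
      · exact hr.elim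
  | all => exact absurd (hOs hD.1) (by decide)
  | atLeast => exact absurd (hOs hD.1) (by decide)

theorem mem_canonicalModel_of_subsumesO {Os : Finset Op}
    (hOs : Os ⊆ ({Op.ex, Op.and, Op.top, Op.bot} : Finset Op))
    {Ont : Ontology} {F : Set Concept} {C : Concept}
    {SC SR : Finset ℕ} {G : Concept} (hG : G.inLang Os SC SR) (hGF : G.subs ⊆ F)
    {E : CanonicalConcept Ont F C} (h : SubsumesO Ont E.1 G) :
    .inl E ∈ G.sem (canonicalModel Ont F C) := by
  induction G generalizing E with
  | atom A => exact h
  | top => trivial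
  | bot =>
    obtain ⟨J, hJ, d, hd⟩ := E.2.2
    exact (h J hJ hd).elim
  | and G G' ih ih' =>
    exact ⟨ih hG.2.1 (fun x hx => hGF (Or.inr (Or.inl hx))) fun J hJ d hd => (h J hJ hd).1,
      ih' hG.2.2 (fun x hx => hGF (Or.inr (Or.inr hx))) fun J hJ d hd => (h J hJ hd).2⟩
  | or => exact absurd (hOs hG.1) (by decide)
  | neg => exact absurd (hOs hG.1) (by decide)
  | ex S G ih =>
    cases S with
    | inv R => exact absurd (hOs hG.2.1.1) (by decide)
    | name R =>
      obtain ⟨E', hE'G, hr⟩ := exists_canonical_successor E (hGF (Or.inl rfl)) h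
      exact ⟨_, hr, ih hG.2.2 (fun x hx => hGF (Or.inr hx)) hE'G⟩
  | all => exact absurd (hOs hG.1) (by decide)
  | atLeast => exact absurd (hOs hG.1) (by decide)

theorem exists_negative_examples {Os : Finset Op}
    (hOs : Os ⊆ ({Op.ex, Op.and, Op.top, Op.bot} : Finset Op))
    (Ont : Ontology) {SC SR : Finset ℕ} {C : Concept}
    (hC : C.inLang Os SC SR) :
    ∃ Eneg : List PInterp, (∀ e ∈ Eneg, e.finite ∧ e.I.satO Ont ∧ e.pt ∉ C.sem e.I) ∧
      ∀ D : Concept, D.inLang Os SC SR → (∀ e ∈ Eneg, e.pt ∉ D.sem e.I) →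
        SubsumesO Ont D C := by
  obtain ⟨N, hN, hSC, hSR⟩ := exists_bound Ont SC SR
  have hfin := finite_realisedType Ont (finite_relevant N C)
  let U := universalModel Ont (relevant N C)
  have hneg : {P : PInterp | ∃ t : U.Δ, t ∉ C.sem U ∧ P = ⟨U, t⟩}.Finite :=
    have : Finite U.Δ := hfin
    (Set.finite_range (fun t : U.Δ => (⟨U, t⟩ : PInterp))).subset
      fun P ⟨t, _, h⟩ => ⟨t, h.symm⟩
  refine ⟨hneg.toFinset.toList, ?_, ?_⟩
  · intro e he
    obtain ⟨t, ht, rfl⟩ := by simpa using he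
    exact ⟨hfin, universalModel_satO C hN, ht⟩
  · intro D hD hfit J hJ d hd
    by_contra hdC
    refine hfit ⟨U, realise _ hJ d⟩ ?_ (realise_mem_of_mem hOs hSC hSR hJ hD hd)
    simp only [Finset.mem_toList, Set.Finite.mem_toFinset]
    exact ⟨realise _ hJ d, fun h => hdC ((mem_universalModel_iff hOs hSR hC
      (subs_subset_relevant N C) (realise _ hJ d)).1 h).2, rfl⟩

theorem exists_positive_examples {Os : Finset Op}
    (hOs : Os ⊆ ({Op.ex, Op.and, Op.top, Op.bot} : Finset Op))
    (Ont : Ontology) {SC SR : Finset ℕ} {C : Concept}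
    (hC : C.inLang Os SC SR) :
    ∃ Epos : List PInterp, (∀ e ∈ Epos, e.finite ∧ e.I.satO Ont ∧ e.pt ∈ C.sem e.I) ∧
      ∀ D : Concept, D.inLang Os SC SR → (∀ e ∈ Epos, e.pt ∈ D.sem e.I) →
        SubsumesO Ont C D := by
  by_cases hsat : SatO Ont C
  · obtain ⟨N, hN, -, -⟩ := exists_bound Ont SC SR
    have hfin := finite_realisedType Ont (finite_relevant N C)
    have hfin' := finite_canonicalConcept Ont (finite_relevant N C) C
    refine ⟨[⟨canonicalModel Ont (relevant N C) C, .inl ⟨C, Or.inl rfl, hsat⟩⟩], ?_, ?_⟩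
    · intro e he
      obtain rfl := by simpa using he
      exact ⟨Finite.instSum, canonicalModel_satO C hN,
        mem_canonicalModel_of_subsumesO hOs hC (subs_subset_relevant N C) fun _ _ _ h => h⟩
    · intro D hD hfit
      exact subsumesO_of_mem_canonicalModel hOs hD (hfit _ (List.mem_singleton_self _))
  · exact ⟨[], by simp, fun D _ _ J hJ d hd => (hsat ⟨J, hJ, d, hd⟩).elim⟩

theorem admitsFinCharO_of_subset {Os : Finset Op}
    (hOs : Os ⊆ ({Op.ex, Op.and, Op.top, Op.bot} : Finset Op))
    (Ont : Ontology) : AdmitsFinCharO Os Ont := by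
  intro SC SR C hC
  obtain ⟨Epos, hpos, hpos'⟩ := exists_positive_examples hOs Ont hC
  obtain ⟨Eneg, hneg, hneg'⟩ := exists_negative_examples hOs Ont hC
  refine ⟨Epos, Eneg, ?_, ⟨fun e he => (hpos e he).2.2, fun e he => (hneg e he).2.2⟩, ?_⟩
  · intro e he
    rcases List.mem_append.1 he with he | he
    · exact ⟨(hpos e he).1, (hpos e he).2.1⟩
    · exact ⟨(hneg e he).1, (hneg e he).2.1⟩
  · intro D hD hfit I hI
    exact Set.Subset.antisymm (hpos' D hD hfit.1 I hI) (hneg' D hD hfit.2 I hI)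

/-! ### Languages without finite characterisations -/

theorem not_admits_of_unsat {Os : Finset Op} {Ont : Ontology} {SC SR : Finset ℕ} {C : Concept}
    (hC : C.inLang Os SC SR) (hunsat : ¬ SatO Ont C) (D : ℕ → Concept)
    (hD : ∀ n, (D n).inLang Os SC SR) (hsat : ∀ n, SatO Ont (D n))
    (hfin : ∀ e : PInterp, e.finite → e.I.satO Ont → {n | e.pt ∈ (D n).sem e.I}.Finite) :
    ¬ AdmitsFinCharO Os Ont := by
  intro h
  obtain ⟨Epos, Eneg, hE, hfit, hchar⟩ := h SC SR C hC
  have hbad : (⋃ e ∈ {e | e ∈ Eneg}, {n | e.pt ∈ (D n).sem e.I}).Finite :=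
    Set.Finite.biUnion (List.finite_toSet Eneg) fun e he =>
      hfin e (hE e (List.mem_append_right _ he)).1 (hE e (List.mem_append_right _ he)).2
  obtain ⟨n, hn⟩ := hbad.infinite_compl.nonempty
  simp only [Set.mem_ofPred_eq, Set.mem_compl_iff, Set.mem_iUnion, not_exists] at hn
  have hequiv := hchar (D n) (hD n) ⟨fun e he => (hunsat
    ⟨e.I, (hE e (List.mem_append_left _ he)).2, e.pt, hfit.1 e he⟩).elim, fun e he => hn e he⟩
  obtain ⟨I, hI, d, hd⟩ := hsat n
  exact hunsat ⟨I, hI, d, by rwa [hequiv I hI]⟩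

/-- `n`-fold existential restriction. -/
def Concept.exIter (S : Role) : ℕ → Concept → Concept
  | 0, C => C
  | n + 1, C => .ex S (exIter S n C)

/-- `n`-fold value restriction. -/
def Concept.allIter (S : Role) : ℕ → Concept → Concept
  | 0, C => C
  | n + 1, C => .all S (allIter S n C)

theorem Concept.exIter_inLang {Os : Finset Op} {SC SR : Finset ℕ} {S : Role} {C : Concept}
    (hex : Op.ex ∈ Os) (hS : S.inSig Os SR) (hC : C.inLang Os SC SR) (n : ℕ) :
    (exIter S n C).inLang Os SC SR := by
  induction n with
  | zero => exact hC
  | succ n ih => exact ⟨hex, hS, ih⟩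

theorem Concept.allIter_inLang {Os : Finset Op} {SC SR : Finset ℕ} {S : Role} {C : Concept}
    (hall : Op.all ∈ Os) (hS : S.inSig Os SR) (hC : C.inLang Os SC SR) (n : ℕ) :
    (allIter S n C).inLang Os SC SR := by
  induction n with
  | zero => exact hC
  | succ n ih => exact ⟨hall, hS, ih⟩

theorem Concept.exIter_sem_mono {I : Interp} {S : Role} {C D : Concept}
    (h : C.sem I ⊆ D.sem I) (n : ℕ) : (exIter S n C).sem I ⊆ (exIter S n D).sem I := by
  induction n with
  | zero => exact h
  | succ n ih => exact fun d ⟨y, hy, hyC⟩ => ⟨y, hy, ih hyC⟩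

theorem Concept.exIter_top_antitone {I : Interp} {S : Role} :
    Antitone fun n => (exIter S n .top).sem I := by
  refine antitone_nat_of_succ_le fun n => ?_
  induction n with
  | zero => exact fun _ _ => trivial
  | succ n ih => exact fun d ⟨y, hy, hyC⟩ => ⟨y, hy, ih hyC⟩

theorem Concept.allIter_sem_of_isEmpty {I : Interp} {S : Role} {C : Concept}
    (hC : C.sem I = ∅) (n : ℕ) :
    (allIter S n C).sem I = ((exIter S n .top).sem I)ᶜ := by
  induction n with
  | zero => simpa [allIter, exIter, Concept.sem] using hC
  | succ n ih => ext d; simp [allIter, exIter, Concept.sem, ih]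

theorem finite_setOf_longest_path {I : Interp} {S : Role} (d : I.Δ) :
    {n | d ∈ (Concept.exIter S n .top).sem I ∧
      d ∉ (Concept.exIter S (n + 1) .top).sem I}.Finite := by
  refine Set.Subsingleton.finite fun m hm n hn => ?_
  by_contra hne
  rcases Nat.lt_or_gt_of_ne hne with h | h
  · exact hm.2 (Concept.exIter_top_antitone (Nat.succ_le_of_lt h) hn.1)
  · exact hn.2 (Concept.exIter_top_antitone (Nat.succ_le_of_lt h) hm.1)

/-- The natural numbers with the predecessor relation, every element satisfying concept
name `0` only. -/
def predModel : Interp where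
  Δ := ℕ
  dom_nonempty := ⟨0⟩
  atom A := {_x | A = 0}
  rel _ x y := x = y + 1

theorem mem_exIter_predModel {C : Concept} (hC : C.sem predModel = Set.univ) (n x : ℕ) :
    Membership.mem (γ := Set ℕ) ((Concept.exIter (.name 0) n C).sem predModel) x ↔ n ≤ x := by
  induction n generalizing x with
  | zero => exact iff_of_true (hC ▸ Set.mem_univ _ : x ∈ C.sem predModel) (Nat.zero_le x)
  | succ n ih =>
    constructor
    · rintro ⟨y, hy, hyC⟩
      exact (Nat.succ_le_succ ((ih y).1 hyC)).trans_eq (Eq.symm hy)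
    · intro h
      exact ⟨(x - 1 : ℕ), show x = x - 1 + 1 by omega, (ih _).2 (by omega)⟩

/-- The ontology stating that concept names `0` and `1` are disjoint. -/
def disjointOnt : Ontology := [⟨.atom 0, .atom 1, true⟩]

theorem disjointOnt_inter_empty {I : Interp} (hI : I.satO disjointOnt) :
    (Concept.and (.atom 0) (.atom 1)).sem I = ∅ := by
  have h : I.atom 0 ⊆ (I.atom 1)ᶜ := hI _ (List.mem_singleton_self _)
  exact Set.eq_empty_of_forall_notMem fun d hd => h hd.1 hd.2

theorem predModel_satO : predModel.satO disjointOnt := by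
  intro ci hci
  obtain rfl := List.mem_singleton.1 hci
  exact fun _ _ h => absurd h one_ne_zero

theorem not_admits_of_neg {Os : Finset Op} (hex : Op.ex ∈ Os) (hand : Op.and ∈ Os)
    (hneg : Op.neg ∈ Os) : ¬ AdmitsFinCharO Os [] := by
  have hA : (Concept.atom 0).inLang Os {0} {0} := Finset.mem_singleton_self 0
  have hR : (Role.name 0).inSig Os {0} := Finset.mem_singleton_self 0
  let botC : Concept := .and (.atom 0) (.neg (.atom 0))
  have hbot : botC.inLang Os {0} {0} := ⟨hand, hA, hneg, hA⟩
  have hntop : (Concept.neg botC).inLang Os {0} {0} := ⟨hneg, hbot⟩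
  have htop (I : Interp) : (Concept.neg botC).sem I = Concept.top.sem I := by
    simp [botC, Concept.sem]
  have hiter (I : Interp) (n : ℕ) : (Concept.exIter (.name 0) n (.neg botC)).sem I =
      (Concept.exIter (.name 0) n .top).sem I :=
    (Concept.exIter_sem_mono (htop I).subset n).antisymm
      (Concept.exIter_sem_mono (htop I).superset n)
  refine not_admits_of_unsat hbot (fun ⟨I, _, d, hd⟩ => hd.2 hd.1)
    (fun n => .and (.exIter (.name 0) n (.neg botC)) (.neg (.exIter (.name 0) (n + 1) (.neg botC))))
    (fun n => ⟨hand, Concept.exIter_inLang hex hR hntop _, hneg,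
      Concept.exIter_inLang hex hR hntop _⟩)
    (fun n => ⟨predModel, by simp [Interp.satO], n,
      (mem_exIter_predModel (htop _) n n).2 le_rfl, fun h =>
        absurd ((mem_exIter_predModel (htop _) (n + 1) n).1 h) (by omega)⟩)
    fun e _ _ => (finite_setOf_longest_path (S := .name 0) e.pt).subset fun n hn => ?_
  rw [Set.mem_ofPred_eq, ← hiter, ← hiter]
  exact hn

theorem not_admits_of_all {Os : Finset Op} (hex : Op.ex ∈ Os) (hand : Op.and ∈ Os)
    (hall : Op.all ∈ Os) : ¬ AdmitsFinCharO Os disjointOnt := by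
  have hA : (Concept.atom 0).inLang Os {0, 1} {0} := by simp [Concept.inLang]
  have hB : (Concept.atom 1).inLang Os {0, 1} {0} := by simp [Concept.inLang]
  have hR : (Role.name 0).inSig Os {0} := Finset.mem_singleton_self 0
  have hatom : (Concept.atom 0).sem predModel = Set.univ :=
    Set.eq_univ_of_forall fun _ => rfl
  have hbot : (Concept.and (.atom 0) (.atom 1)).inLang Os {0, 1} {0} := ⟨hand, hA, hB⟩
  refine not_admits_of_unsat hbot
    (fun ⟨I, hI, d, hd⟩ => by rwa [disjointOnt_inter_empty hI] at hd)
    (fun n => .and (.exIter (.name 0) n (.atom 0))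
      (.allIter (.name 0) (n + 1) (.and (.atom 0) (.atom 1))))
    (fun n => ⟨hand, Concept.exIter_inLang hex hR hA _, Concept.allIter_inLang hall hR hbot _⟩)
    (fun n => ⟨predModel, predModel_satO, n, (mem_exIter_predModel hatom n n).2 le_rfl, ?_⟩)
    fun e _ he => (finite_setOf_longest_path (S := .name 0) e.pt).subset fun n hn => ?_
  · rw [Concept.allIter_sem_of_isEmpty (disjointOnt_inter_empty predModel_satO)]
    exact fun h => absurd ((mem_exIter_predModel rfl (n + 1) n).1 h) (by omega)
  · rw [Set.mem_ofPred_eq, ← Set.mem_compl_iff,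
      ← Concept.allIter_sem_of_isEmpty (disjointOnt_inter_empty he)]
    exact ⟨Concept.exIter_sem_mono (Set.subset_univ _) n hn.1, hn.2⟩

/-- The natural numbers with the total relation, every element satisfying concept
name `0` only. -/
def totalModel : Interp where
  Δ := ℕ
  dom_nonempty := ⟨0⟩
  atom A := {_x | A = 0}
  rel _ _ _ := True

theorem totalModel_satO : totalModel.satO disjointOnt := by
  intro ci hci
  obtain rfl := List.mem_singleton.1 hci
  exact fun _ _ h => absurd h one_ne_zero

theorem not_admits_of_ge {Os : Finset Op} (hand : Op.and ∈ Os) (hge : Op.ge ∈ Os) :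
    ¬ AdmitsFinCharO Os disjointOnt := by
  have hA : (Concept.atom 0).inLang Os {0, 1} {0} := by simp [Concept.inLang]
  have hB : (Concept.atom 1).inLang Os {0, 1} {0} := by simp [Concept.inLang]
  have hR : (Role.name 0).inSig Os {0} := Finset.mem_singleton_self 0
  refine not_admits_of_unsat (C := .and (.atom 0) (.atom 1)) ⟨hand, hA, hB⟩
    (fun ⟨I, hI, d, hd⟩ => by rwa [disjointOnt_inter_empty hI] at hd)
    (fun n => .atLeast (n + 1) (.name 0) (.atom 0))
    (fun n => ⟨hge, Nat.succ_pos n, hR, hA⟩)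
    (fun n => ⟨totalModel, totalModel_satO, (0 : ℕ), Finset.range (n + 1),
      Finset.card_range _, fun _ _ => ⟨trivial, rfl⟩⟩)
    fun e hfin _ => (Set.finite_Iio (Nat.card e.I.Δ)).subset ?_
  rintro n ⟨s, hs, -⟩
  have : Finite e.I.Δ := hfin
  have : Fintype e.I.Δ := Fintype.ofFinite _
  have hle := s.card_le_univ
  rw [hs, ← Nat.card_eq_fintype_card] at hle
  exact hle

/-- The ontology `{A ⊑ ∃R, ∃R⁻ ⊑ ∃R, ∃R ⊑ T}`. -/
def chainOnt : Ontology :=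
  [⟨.atom 0, .ex (.name 0), false⟩, ⟨.ex (.inv 0), .ex (.name 0), false⟩,
    ⟨.ex (.name 0), .atom 1, false⟩]

/-- The infinite chain whose first element satisfies concept name `0`. -/
def chainModel : Interp where
  Δ := ℕ
  dom_nonempty := ⟨0⟩
  atom A := {x | A = 0 → x = 0}
  rel _ x y := y = x + 1

theorem chainModel_satO : chainModel.satO chainOnt := by
  intro ci hci
  simp only [chainOnt, List.mem_cons, List.not_mem_nil, or_false] at hci
  rcases hci with rfl | rfl | rfl
  · exact fun (x : ℕ) _ => ⟨(x + 1 : ℕ), rfl⟩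
  · exact fun (x : ℕ) _ => ⟨(x + 1 : ℕ), rfl⟩
  · exact fun _ _ h => absurd h one_ne_zero

/-- There is a successor path of length `n` to an element with a predecessor path of length
`n + 1`. -/
def zigzag (n : ℕ) : Concept :=
  .exIter (.name 0) n (.exIter (.inv 0) (n + 1) (.atom 1))

theorem le_of_mem_exIter_inv_chainModel {C : Concept} {n x : ℕ}
    (h : Membership.mem (γ := Set ℕ) ((Concept.exIter (.inv 0) n C).sem chainModel) x) :
    n ≤ x := by
  induction n generalizing x with
  | zero => exact Nat.zero_le x
  | succ n ih =>
    obtain ⟨y, hy, hyC⟩ := h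
    exact (Nat.succ_le_succ (ih hyC)).trans_eq (Eq.symm hy)

theorem exists_of_mem_exIter_chainModel {C : Concept} {n x : ℕ}
    (h : Membership.mem (γ := Set ℕ) ((Concept.exIter (.name 0) n C).sem chainModel) x) :
    Membership.mem (γ := Set ℕ) (C.sem chainModel) (x + n) := by
  induction n generalizing x with
  | zero => exact h
  | succ n ih =>
    obtain ⟨y, hy, hyC⟩ := h
    have h' := ih hyC
    obtain rfl : y = x + 1 := hy
    exact Nat.add_right_comm x 1 n ▸ h'

theorem notMem_zigzag_chainModel (n : ℕ) :
    ¬ Membership.mem (γ := Set ℕ) ((zigzag n).sem chainModel) 0 := fun h => by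
  have := le_of_mem_exIter_inv_chainModel (exists_of_mem_exIter_chainModel h)
  omega

theorem exists_chain {I : Interp} (hI : I.satO chainOnt) {d : I.Δ} (hd : d ∈ I.atom 0) :
    ∃ f : ℕ → I.Δ, f 0 = d ∧ ∀ n, I.rel 0 (f n) (f (n + 1)) := by
  have h₁ : I.atom 0 ⊆ {x | ∃ y, I.rel 0 x y} :=
    hI ⟨.atom 0, .ex (.name 0), false⟩ (by simp [chainOnt])
  have h₂ : {x | ∃ y, I.rel 0 y x} ⊆ {x | ∃ y, I.rel 0 x y} :=
    hI ⟨.ex (.inv 0), .ex (.name 0), false⟩ (by simp [chainOnt])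
  have hsucc (x : {x | ∃ y, I.rel 0 x y}) : ∃ y : {x | ∃ y, I.rel 0 x y}, I.rel 0 x.1 y.1 := by
    obtain ⟨y, hy⟩ := x.2
    exact ⟨⟨y, h₂ ⟨x.1, hy⟩⟩, hy⟩
  choose g hg using hsucc
  let x₀ : {x | ∃ y, I.rel 0 x y} := ⟨d, h₁ hd⟩
  exact ⟨fun n => (g^[n] x₀).1, rfl, fun n => by
    simpa only [Function.iterate_succ_apply'] using hg (g^[n] x₀)⟩

theorem eventually_mem_zigzag {I : Interp} [Finite I.Δ] (hI : I.satO chainOnt) {d : I.Δ}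
    (hd : d ∈ I.atom 0) : ∀ᶠ n in Filter.atTop, d ∈ (zigzag n).sem I := by
  obtain ⟨f, rfl, hf⟩ := exists_chain hI hd
  have hT : {x | ∃ y, I.rel 0 x y} ⊆ I.atom 1 :=
    hI ⟨.ex (.name 0), .atom 1, false⟩ (by simp [chainOnt])
  obtain ⟨i, j, hij, heq⟩ : ∃ i j, i < j ∧ f i = f j := by
    obtain ⟨i, j, hne, heq⟩ := Finite.exists_ne_map_eq_of_infinite f
    rcases Nat.lt_or_gt_of_ne hne with h | h
    · exact ⟨i, j, h, heq⟩
    · exact ⟨j, i, h, heq.symm⟩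
  have hback (m : ℕ) : ∀ k, i ≤ k → f k ∈ (Concept.exIter (.inv 0) m (.atom 1)).sem I := by
    induction m with
    | zero => exact fun k _ => hT ⟨_, hf k⟩
    | succ m ih =>
      intro k hk
      rcases hk.eq_or_lt with rfl | hk
      · refine ⟨f (j - 1), ?_, ih _ (by omega)⟩
        have h := hf (j - 1)
        rwa [Nat.sub_add_cancel (by omega), ← heq] at h
      · refine ⟨f (k - 1), ?_, ih _ (by omega)⟩
        have h := hf (k - 1)
        rwa [Nat.sub_add_cancel (by omega)] at h
  have hforth (C : Concept) (n : ℕ) : ∀ k, f (k + n) ∈ C.sem I →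
      f k ∈ (Concept.exIter (.name 0) n C).sem I := by
    induction n with
    | zero => exact fun k h => h
    | succ n ih =>
      exact fun k h => ⟨f (k + 1), hf k, ih (k + 1) (by rwa [Nat.add_right_comm, Nat.add_assoc])⟩
  filter_upwards [Filter.eventually_ge_atTop i] with n hn
  exact hforth _ n 0 (hback _ _ (by omega))

theorem not_admits_of_inv {Os : Finset Op} (hex : Op.ex ∈ Os) (hand : Op.and ∈ Os)
    (hinv : Op.inv ∈ Os) : ¬ AdmitsFinCharO Os chainOnt := by
  intro h
  have hA : (Concept.atom 0).inLang Os {0, 1} {0} := by simp [Concept.inLang]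
  have hT : (Concept.atom 1).inLang Os {0, 1} {0} := by simp [Concept.inLang]
  have hR : (Role.name 0).inSig Os {0} := Finset.mem_singleton_self 0
  have hR' : (Role.inv 0).inSig Os {0} := ⟨hinv, Finset.mem_singleton_self 0⟩
  obtain ⟨Epos, Eneg, hE, hfit, hchar⟩ := h {0, 1} {0} (.atom 0) hA
  have hev : ∀ᶠ n in Filter.atTop, ∀ e ∈ {e | e ∈ Epos}, e.pt ∈ (zigzag n).sem e.I := by
    rw [Filter.eventually_all_finite (List.finite_toSet Epos)]
    intro e he
    have hEe := hE e (List.mem_append_left _ he)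
    have : Finite e.I.Δ := hEe.1
    exact eventually_mem_zigzag hEe.2 (hfit.1 e he)
  obtain ⟨n, hn⟩ := hev.exists
  have hequiv := hchar (.and (.atom 0) (zigzag n))
    ⟨hand, hA, Concept.exIter_inLang hex hR (Concept.exIter_inLang hex hR' hT _) _⟩
    ⟨fun e he => ⟨hfit.1 e he, hn e he⟩, fun e he hmem => hfit.2 e he hmem.1⟩
    chainModel chainModel_satO
  have hmem : Membership.mem (γ := Set ℕ) ((Concept.atom 0).sem chainModel) 0 := fun _ => rfl
  rw [hequiv] at hmem
  exact notMem_zigzag_chainModel n hmem.2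

/-- **Theorem 3 (classification under DL-Lite ontologies)**.
Let `{∃,⊓} ⊆ Os ⊆ {∀,∃,≥,−,⊓,⊔,⊤,⊥,¬}`.
(1) If `Os ⊆ {∃,⊓,⊤,⊥}`, then `L(Os)` admits finite characterisations under
every DL-Lite ontology.
(2) Otherwise, unless `{∃,⊓,⊔} ⊆ Os ⊆ {∃,⊓,⊔,⊤,⊥}`, there is a DL-Lite
ontology under which `L(Os)` does not admit finite characterisations. -/
theorem classification_with_ontology (Os : Finset Op)
    (hlo : ({Op.ex, Op.and} : Finset Op) ⊆ Os)
    (hhi : Os ⊆ ({Op.all, Op.ex, Op.ge, Op.inv, Op.and, Op.or, Op.top, Op.bot, Op.neg} : Finset Op)) :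
    ((Os ⊆ ({Op.ex, Op.and, Op.top, Op.bot} : Finset Op)) →
        ∀ Ont : Ontology, AdmitsFinCharO Os Ont) ∧
    ((¬ Os ⊆ ({Op.ex, Op.and, Op.top, Op.bot} : Finset Op)) →
      ¬ (({Op.ex, Op.and, Op.or} : Finset Op) ⊆ Os ∧
         Os ⊆ ({Op.ex, Op.and, Op.or, Op.top, Op.bot} : Finset Op)) →
      ∃ Ont : Ontology, ¬ AdmitsFinCharO Os Ont) := by
  have hex : Op.ex ∈ Os := hlo (by simp)
  have hand : Op.and ∈ Os := hlo (by simp)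
  refine ⟨fun hOs Ont => admitsFinCharO_of_subset hOs Ont, fun h₁ h₂ => ?_⟩
  by_cases hneg : Op.neg ∈ Os
  · exact ⟨_, not_admits_of_neg hex hand hneg⟩
  by_cases hall : Op.all ∈ Os
  · exact ⟨_, not_admits_of_all hex hand hall⟩
  by_cases hge : Op.ge ∈ Os
  · exact ⟨_, not_admits_of_ge hand hge⟩
  by_cases hinv : Op.inv ∈ Os
  · exact ⟨_, not_admits_of_inv hex hand hinv⟩
  exfalso
  have hor : Os ⊆ ({Op.ex, Op.and, Op.or, Op.top, Op.bot} : Finset Op) := by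
    intro o ho
    cases o <;> first | decide | contradiction
  refine h₂ ⟨?_, hor⟩
  by_contra hno
  refine h₁ fun o ho => ?_
  cases o <;> first | decide | contradiction | skip
  exact (hno (by simp [Finset.insert_subset_iff, hex, hand, ho])).elim

end DL
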